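/- arXiv:2604.15698 — 2 statements merged into one kernel-verified Lean document; each statement's English description precedes it below -/
import Mathlib

section
/- Assume P_A > 0 and A ⊆ Ŝ_O. Then there exists a test channel W from S_O to Ŝ_O that achieves zero closure distortion for p and satisfies I(p,W) = P_A·H(π_A). Consequently R_sem(0) ≤ P_A·H(π_A). -/
open scoped BigOperators Classical

noncomputable section

variable {𝕊 : Type*} [Fintype 𝕊]

/-- One step of the deletion procedure. -/
def atomStep (Cn : Set 𝕊 → Set 𝕊) (A : Set 𝕊) (s : 𝕊) : Set 𝕊 :=
  if s ∈ Cn (A \ {s}) then A \ {s} else A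

/-- The deletion procedure; `Atom(S_O) = atomCore Cn S_O L`. -/
def atomCore (Cn : Set 𝕊 → Set 𝕊) (S : Set 𝕊) (L : List 𝕊) : Set 𝕊 :=
  L.foldl (atomStep Cn) S

/-- Shannon entropy of a probability vector on a finite type
(natural logarithm; `Real.log 0 = 0` handles the `0·log 0 := 0` convention). -/
def entropy {X : Type*} [Fintype X] (p : X → ℝ) : ℝ :=
  -∑ x, p x * Real.log (p x)

/-- Mutual information `I(p,W) := H(p) + H(q̂) − H(q)` of a source `p` and a
channel `W`, where `q(x,y) = p(x)·W(y|x)` and `q̂` is the output marginal. -/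
def mutualInfo {X Y : Type*} [Fintype X] [Fintype Y]
    (p : X → ℝ) (W : X → Y → ℝ) : ℝ :=
  entropy p + entropy (fun y => ∑ x, p x * W x y)
    - entropy (fun z : X × Y => p z.1 * W z.1 z.2)

/-- A test channel into the alphabet `Yset`: rows are probability vectors
supported inside `Yset`. -/
def IsChannel {X Y : Type*} [Fintype Y] (W : X → Y → ℝ) (Yset : Set Y) : Prop :=
  (∀ x y, 0 ≤ W x y) ∧ (∀ x, ∑ y, W x y = 1) ∧ (∀ x y, W x y ≠ 0 → y ∈ Yset)

/-- A probability vector supported on `S`. -/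
def IsProbVector {X : Type*} [Fintype X] (p : X → ℝ) (S : Set X) : Prop :=
  (∀ x, 0 ≤ p x) ∧ (∑ x, p x = 1) ∧ (∀ x, p x ≠ 0 → x ∈ S)

/-- The probability mass `p(A)` of a set `A`. -/
def massOn {X : Type*} [Fintype X] (p : X → ℝ) (A : Set X) : ℝ :=
  ∑ x, if x ∈ A then p x else 0

/-- The conditional distribution of `p` given `A`. -/
def condOn {X : Type*} [Fintype X] (p : X → ℝ) (A : Set X) : X → ℝ :=
  fun x => if x ∈ A then p x / massOn p A else 0

/-- Zero-distortion reconstruction set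
`R_Cn(s) := {shat ∈ Shat_O : Cn((S_O \ {s}) ∪ {shat}) = Cn(S_O)}`. -/
def RCn (Cn : Set 𝕊 → Set 𝕊) (S_O Shat_O : Set 𝕊) (s : 𝕊) : Set 𝕊 :=
  {shat ∈ Shat_O | Cn ((S_O \ {s}) ∪ {shat}) = Cn S_O}

/-- The channel `W` achieves zero closure distortion for the source `p`. -/
def ZeroClosureDist (Cn : Set 𝕊 → Set 𝕊) (S_O : Set 𝕊)
    (p : 𝕊 → ℝ) (W : 𝕊 → 𝕊 → ℝ) : Prop :=
  ∀ s : 𝕊, 0 < p s → ∀ shat : 𝕊, 0 < W s shat →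
    Cn ((S_O \ {s}) ∪ {shat}) = Cn S_O

/-- `R_sem(0)`: the infimum of `I(p,W)` over all zero-closure-distortion test
channels from `S_O` to `Shat_O` (infimum of the empty set is `⊤ = +∞`). -/
def RsemZero (Cn : Set 𝕊 → Set 𝕊) (S_O Shat_O : Set 𝕊) (p : 𝕊 → ℝ) : EReal :=
  sInf {r : EReal | ∃ W : 𝕊 → 𝕊 → ℝ, IsChannel W Shat_O ∧
    ZeroClosureDist Cn S_O p W ∧ r = ((mutualInfo p W : ℝ) : EReal)}

omit [Fintype 𝕊] in
theorem atomCore_subset (Cn : Set 𝕊 → Set 𝕊) (S : Set 𝕊) (L : List 𝕊) :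
    atomCore Cn S L ⊆ S := by
  unfold atomCore
  induction L generalizing S with
  | nil => exact subset_rfl
  | cons s L ih =>
    refine (ih _).trans ?_
    unfold atomStep
    split_ifs
    · exact Set.sdiff_subset
    · exact subset_rfl

omit [Fintype 𝕊] in
theorem closure_atomStep (Cn : Set 𝕊 → Set 𝕊)
    (hrefl : ∀ Γ : Set 𝕊, Γ ⊆ Cn Γ)
    (hmono : ∀ Γ Γ' : Set 𝕊, Γ ⊆ Γ' → Cn Γ ⊆ Cn Γ')
    (hidem : ∀ Γ : Set 𝕊, Cn (Cn Γ) = Cn Γ) (A : Set 𝕊) (s : 𝕊) :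
    Cn (atomStep Cn A s) = Cn A := by
  unfold atomStep
  split_ifs with h
  · refine (hmono _ _ Set.sdiff_subset).antisymm ?_
    rw [← hidem (A \ {s})]
    refine hmono _ _ fun x hx => ?_
    by_cases hxs : x = s
    · exact hxs ▸ h
    · exact hrefl _ ⟨hx, hxs⟩
  · rfl

omit [Fintype 𝕊] in
theorem closure_atomCore (Cn : Set 𝕊 → Set 𝕊)
    (hrefl : ∀ Γ : Set 𝕊, Γ ⊆ Cn Γ)
    (hmono : ∀ Γ Γ' : Set 𝕊, Γ ⊆ Γ' → Cn Γ ⊆ Cn Γ')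
    (hidem : ∀ Γ : Set 𝕊, Cn (Cn Γ) = Cn Γ) (S : Set 𝕊) (L : List 𝕊) :
    Cn (atomCore Cn S L) = Cn S := by
  unfold atomCore
  induction L generalizing S with
  | nil => rfl
  | cons s L ih =>
    exact (ih _).trans (closure_atomStep Cn hrefl hmono hidem S s)

/-- Chain rule: the joint entropy is the source entropy plus the average row entropy. -/
theorem entropy_joint {X Y : Type*} [Fintype X] [Fintype Y] (p : X → ℝ) (W : X → Y → ℝ)
    (hW : ∀ x, ∑ y, W x y = 1) :
    entropy (fun z : X × Y => p z.1 * W z.1 z.2) =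
      entropy p + ∑ x, p x * entropy (W x) := by
  unfold entropy
  rw [Fintype.sum_prod_type, ← Finset.sum_neg_distrib, ← Finset.sum_neg_distrib,
    ← Finset.sum_add_distrib]
  refine Finset.sum_congr rfl fun x _ => ?_
  have key : ∀ y, p x * W x y * Real.log (p x * W x y) =
      p x * Real.log (p x) * W x y + p x * (W x y * Real.log (W x y)) := by
    intro y
    by_cases h1 : p x = 0
    · simp [h1]
    by_cases h2 : W x y = 0
    · simp [h2]
    rw [Real.log_mul h1 h2]
    ring
  simp only [key, Finset.sum_add_distrib, ← Finset.mul_sum, hW]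
  ring

theorem entropy_ite_eq {X : Type*} [Fintype X] (x : X) :
    entropy (fun y => if y = x then (1 : ℝ) else 0) = 0 := by
  unfold entropy
  rw [neg_eq_zero]
  refine Finset.sum_eq_zero fun y _ => ?_
  by_cases h : y = x <;> simp [h]

theorem sum_condOn {X : Type*} [Fintype X] (p : X → ℝ) (A : Set X) (hA : massOn p A ≠ 0) :
    ∑ x, condOn p A x = 1 := by
  have h : ∀ x, condOn p A x = (if x ∈ A then p x else 0) / massOn p A := by
    intro x
    unfold condOn
    split_ifs <;> simp
  simp only [h, ← Finset.sum_div]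
  exact div_self hA

theorem sum_compl_eq {X : Type*} [Fintype X] (p : X → ℝ) (A : Set X) (hp : ∑ x, p x = 1) :
    ∑ x, (if x ∈ A then 0 else p x) = 1 - massOn p A := by
  rw [← hp, massOn, ← Finset.sum_sub_distrib]
  refine Finset.sum_congr rfl fun x _ => ?_
  split_ifs <;> simp

/-- The channel that keeps elements of `A` and resamples everything else from `p` given `A`. -/
def coreChannel {X : Type*} [Fintype X] (p : X → ℝ) (A : Set X) (x y : X) : ℝ :=
  if x ∈ A then (if y = x then 1 else 0) else condOn p A y

theorem coreChannel_ne_zero {X : Type*} [Fintype X] {p : X → ℝ} {A : Set X} {x y : X}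
    (h : coreChannel p A x y ≠ 0) : y ∈ A ∧ (x ∈ A → y = x) := by
  unfold coreChannel condOn at h
  split_ifs at h <;> simp_all

theorem isChannel_coreChannel {X : Type*} [Fintype X] (p : X → ℝ) (A : Set X)
    (hp : ∀ x, 0 ≤ p x) (hA : 0 < massOn p A) : IsChannel (coreChannel p A) A := by
  refine ⟨fun x y => ?_, fun x => ?_, fun x y h => (coreChannel_ne_zero h).1⟩
  · unfold coreChannel condOn
    split_ifs
    exacts [zero_le_one, le_rfl, div_nonneg (hp y) hA.le, le_rfl]
  · by_cases hx : x ∈ A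
    · simp [coreChannel, hx]
    · simpa [coreChannel, hx] using sum_condOn p A hA.ne'

theorem output_coreChannel {X : Type*} [Fintype X] (p : X → ℝ) (A : Set X)
    (hp : ∑ x, p x = 1) (hA : massOn p A ≠ 0) (y : X) :
    ∑ x, p x * coreChannel p A x y = condOn p A y := by
  have h : ∀ x, p x * coreChannel p A x y =
      (if y = x then (if x ∈ A then p x else 0) else 0) +
        (if x ∈ A then 0 else p x) * condOn p A y := by
    intro x
    unfold coreChannel
    split_ifs <;> simp
  simp only [h, Finset.sum_add_distrib, ← Finset.sum_mul, sum_compl_eq p A hp,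
    Finset.sum_ite_eq, Finset.mem_univ, if_true]
  unfold condOn
  split_ifs
  · field_simp
    ring
  · simp

theorem mutualInfo_coreChannel {X : Type*} [Fintype X] (p : X → ℝ) (A : Set X)
    (hp : ∀ x, 0 ≤ p x) (hsum : ∑ x, p x = 1) (hA : 0 < massOn p A) :
    mutualInfo p (coreChannel p A) = massOn p A * entropy (condOn p A) := by
  have hrow : ∀ x, p x * entropy (coreChannel p A x) =
      (if x ∈ A then 0 else p x) * entropy (condOn p A) := by
    intro x
    by_cases hx : x ∈ A
    · have h : coreChannel p A x = fun y => if y = x then (1 : ℝ) else 0 := by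
        funext y
        simp [coreChannel, hx]
      rw [h, entropy_ite_eq]
      simp [hx]
    · have h : coreChannel p A x = condOn p A := by
        funext y
        simp [coreChannel, hx]
      simp [h, hx]
  unfold mutualInfo
  rw [entropy_joint p _ (isChannel_coreChannel p A hp hA).2.1]
  simp only [output_coreChannel p A hsum hA.ne', hrow, ← Finset.sum_mul,
    sum_compl_eq p A hsum]
  ring

theorem zeroClosureDist_coreChannel (Cn : Set 𝕊 → Set 𝕊)
    (hmono : ∀ Γ Γ' : Set 𝕊, Γ ⊆ Γ' → Cn Γ ⊆ Cn Γ')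
    (S A : Set 𝕊) (hAS : A ⊆ S) (hA : Cn A = Cn S) (p : 𝕊 → ℝ) :
    ZeroClosureDist Cn S p (coreChannel p A) := by
  intro s _ t ht
  obtain ⟨htA, hts⟩ := coreChannel_ne_zero ht.ne'
  refine (hmono _ _ (Set.union_subset Set.sdiff_subset
    (Set.singleton_subset_iff.2 (hAS htA)))).antisymm ?_
  rw [← hA]
  refine hmono _ _ fun x hx => ?_
  by_cases hxs : x = s
  · subst hxs
    exact Or.inr (hts hx).symm
  · exact Or.inl ⟨hAS hx, hxs⟩

/-- Zero-distortion achievability: if `P_A > 0` and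
`A ⊆ Shat_O`, there is a zero-closure-distortion test channel with mutual
information exactly `P_A·H(π_A)`; consequently `R_sem(0) ≤ P_A·H(π_A)`. -/
theorem zero_distortion_achievability
    (Cn : Set 𝕊 → Set 𝕊)
    (hrefl : ∀ Γ : Set 𝕊, Γ ⊆ Cn Γ)
    (hmono : ∀ Γ Γ' : Set 𝕊, Γ ⊆ Γ' → Cn Γ ⊆ Cn Γ')
    (hidem : ∀ Γ : Set 𝕊, Cn (Cn Γ) = Cn Γ)
    (S_O Shat_O : Set 𝕊) (L : List 𝕊)
    (hnodup : L.Nodup)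
    (henum : ∀ s : 𝕊, s ∈ L ↔ s ∈ S_O)
    (p : 𝕊 → ℝ) (hp : IsProbVector p S_O)
    (hPA : 0 < massOn p (atomCore Cn S_O L))
    (hAsub : atomCore Cn S_O L ⊆ Shat_O) :
    (∃ W : 𝕊 → 𝕊 → ℝ, IsChannel W Shat_O ∧ ZeroClosureDist Cn S_O p W ∧
        mutualInfo p W =
          massOn p (atomCore Cn S_O L) *
            entropy (condOn p (atomCore Cn S_O L))) ∧
      RsemZero Cn S_O Shat_O p ≤
        ((massOn p (atomCore Cn S_O L) *
            entropy (condOn p (atomCore Cn S_O L)) : ℝ) : EReal) := by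
  have hex : ∃ W : 𝕊 → 𝕊 → ℝ, IsChannel W Shat_O ∧ ZeroClosureDist Cn S_O p W ∧
      mutualInfo p W =
        massOn p (atomCore Cn S_O L) * entropy (condOn p (atomCore Cn S_O L)) := by
    obtain ⟨h0, h1, h2⟩ := isChannel_coreChannel p _ hp.1 hPA
    exact ⟨_, ⟨h0, h1, fun x y h => hAsub (h2 x y h)⟩,
      zeroClosureDist_coreChannel Cn hmono S_O _ (atomCore_subset Cn S_O L)
        (closure_atomCore Cn hrefl hmono hidem S_O L) p,
      mutualInfo_coreChannel p _ hp.1 hp.2.1 hPA⟩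
  refine ⟨hex, ?_⟩
  obtain ⟨W, hW, hzero, hinfo⟩ := hex
  exact sInf_le ⟨W, hW, hzero, by rw [hinfo]⟩

end
end

section
/- Fix δ ≥ 0 and assume Ŝ_O is nonempty. Define the δ-step distortion d^δ(s,ŝ) := 0 if S_O ⊆ T^δ((S_O \ {s}) ∪ {ŝ}) and d^δ(s,ŝ) := 1 otherwise. Define R_sem(D,δ) as the infimum of I(p,W) over all test channels W from S_O to Ŝ_O with Σ_{s,ŝ} p(s)·W(ŝ|s)·d^δ(s,ŝ) ≤ D (inf ∅ := +∞), and define R^{(A_δ)}(D') as the infimum of I(π_δ, V) over all test channels V from A_δ to Ŝ_O with Σ_{a,ŝ} π_δ(a)·V(ŝ|a)·d^δ(a,ŝ) ≤ D' (inf ∅ := +∞). Then for every D ≥ 0: if P_δ = 0 then R_sem(D,δ) = 0, and if P_δ > 0 then R_sem(D,δ) = P_δ · R^{(A_δ)}(D / P_δ). -/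
open scoped BigOperators Classical

noncomputable section

variable {𝕊 : Type*} [Fintype 𝕊]

/-- The δ-irredundant core `A_δ := {s ∈ S_O : s ∉ T^δ(S_O \ {s})}`. -/
def deltaCore (T : Set 𝕊 → Set 𝕊) (S : Set 𝕊) (δ : ℕ) : Set 𝕊 :=
  {s ∈ S | s ∉ T^[δ] (S \ {s})}

/-- The channel `W` achieves zero δ-step distortion for the source `p`:
whenever `p(s) > 0` and `W(shat|s) > 0`, the whole source is recovered within
`δ` iterations of `T` after replacing `s` by `shat`. -/
def ZeroDeltaDist (T : Set 𝕊 → Set 𝕊) (S_O : Set 𝕊) (δ : ℕ)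
    (p : 𝕊 → ℝ) (W : 𝕊 → 𝕊 → ℝ) : Prop :=
  ∀ s : 𝕊, 0 < p s → ∀ shat : 𝕊, 0 < W s shat →
    S_O ⊆ T^[δ] ((S_O \ {s}) ∪ {shat})

/-- The δ-step (binary) distortion: `0` if the whole source is recovered
within `δ` iterations of `T` after replacing `s` by `shat`, else `1`. -/
def dDelta (T : Set 𝕊 → Set 𝕊) (S_O : Set 𝕊) (δ : ℕ) (s shat : 𝕊) : ℝ :=
  if S_O ⊆ T^[δ] ((S_O \ {s}) ∪ {shat}) then 0 else 1

/-- The rate–depth–distortion function `R_sem(D,δ)` (infimum of the empty set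
is `⊤ = +∞`). -/
def RsemDdelta (T : Set 𝕊 → Set 𝕊) (S_O Shat_O : Set 𝕊) (p : 𝕊 → ℝ)
    (D : ℝ) (δ : ℕ) : EReal :=
  sInf {r : EReal | ∃ W : 𝕊 → 𝕊 → ℝ, IsChannel W Shat_O ∧
    (∑ s, ∑ shat, p s * W s shat * dDelta T S_O δ s shat) ≤ D ∧
    r = ((mutualInfo p W : ℝ) : EReal)}

/-- The δ-core sub-source rate–distortion function `R^{(A_δ)}(D')` (infimum
of the empty set is `⊤ = +∞`). -/
def RdeltaCoreD (T : Set 𝕊 → Set 𝕊) (S_O Shat_O : Set 𝕊) (π : 𝕊 → ℝ)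
    (D' : ℝ) (δ : ℕ) : EReal :=
  sInf {r : EReal | ∃ V : 𝕊 → 𝕊 → ℝ, IsChannel V Shat_O ∧
    (∑ a, ∑ shat, π a * V a shat * dDelta T S_O δ a shat) ≤ D' ∧
    r = ((mutualInfo π V : ℝ) : EReal)}

/-- The Kullback–Leibler divergence of `f` from `g`, as a finite sum; it is the usual one when
`g y = 0` implies `f y = 0`. -/
def klSum {Y : Type*} [Fintype Y] (f g : Y → ℝ) : ℝ :=
  ∑ y, f y * (Real.log (f y) - Real.log (g y))

/-- The output marginal of the channel `W` with source `p`. -/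
def outMarginal {X Y : Type*} [Fintype X] (p : X → ℝ) (W : X → Y → ℝ) : Y → ℝ :=
  fun y => ∑ x, p x * W x y

theorem klSum_self {Y : Type*} [Fintype Y] (f : Y → ℝ) : klSum f f = 0 := by
  simp [klSum]

theorem sub_le_mul_log_sub_log {a b : ℝ} (ha : 0 ≤ a) (hb : 0 ≤ b) (hab : b = 0 → a = 0) :
    a - b ≤ a * (Real.log a - Real.log b) := by
  rcases ha.eq_or_lt with rfl | ha'
  · simpa using hb
  have hb' : 0 < b := hb.lt_of_ne fun h => ha'.ne' (hab h.symm)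
  have h := Real.log_le_sub_one_of_pos (div_pos hb' ha')
  rw [Real.log_div hb'.ne' ha'.ne'] at h
  have h2 := mul_le_mul_of_nonneg_left h ha
  have h3 : a * (b / a - 1) = b - a := by field_simp
  linarith

/-- The Gibbs inequality. -/
theorem klSum_nonneg {Y : Type*} [Fintype Y] {f g : Y → ℝ} (hf : ∀ y, 0 ≤ f y)
    (hg : ∀ y, 0 ≤ g y) (hfg : ∀ y, g y = 0 → f y = 0) (hsum : ∑ y, f y = ∑ y, g y) :
    0 ≤ klSum f g := by
  have h : ∑ y, (f y - g y) ≤ klSum f g :=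
    Finset.sum_le_sum fun y _ => sub_le_mul_log_sub_log (hf y) (hg y) (hfg y)
  rwa [Finset.sum_sub_distrib, hsum, sub_self] at h

section Channels

variable {X Y : Type*} [Fintype X] [Fintype Y] {p : X → ℝ} {W : X → Y → ℝ}

omit [Fintype Y] in
theorem outMarginal_nonneg (hp : ∀ x, 0 ≤ p x) (hW : ∀ x y, 0 ≤ W x y) (y : Y) :
    0 ≤ outMarginal p W y :=
  Finset.sum_nonneg fun x _ => mul_nonneg (hp x) (hW x y)

theorem sum_outMarginal (hW : ∀ x, ∑ y, W x y = 1) :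
    ∑ y, outMarginal p W y = ∑ x, p x := by
  unfold outMarginal
  rw [Finset.sum_comm]
  simp [← Finset.mul_sum, hW]

omit [Fintype Y] in
theorem outMarginal_eq_zero (hp : ∀ x, 0 ≤ p x) (hW : ∀ x y, 0 ≤ W x y) {y : Y}
    (h : outMarginal p W y = 0) (x : X) : p x * W x y = 0 :=
  (Finset.sum_eq_zero_iff_of_nonneg fun x _ => mul_nonneg (hp x) (hW x y)).1 h x
    (Finset.mem_univ x)

theorem sum_mul_klSum (r : Y → ℝ) :
    ∑ x, p x * klSum (W x) r =
      ∑ x, ∑ y, p x * W x y * Real.log (W x y) - ∑ y, outMarginal p W y * Real.log (r y) := by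
  simp only [klSum, outMarginal, Finset.sum_mul, Finset.mul_sum]
  rw [Finset.sum_comm (s := (Finset.univ : Finset Y)), ← Finset.sum_sub_distrib]
  refine Finset.sum_congr rfl fun x _ => ?_
  rw [← Finset.sum_sub_distrib]
  exact Finset.sum_congr rfl fun y _ => by ring

/-- Mutual information is the average divergence of the rows from the output marginal. -/
theorem mutualInfo_eq_sum_klSum (hW : ∀ x, ∑ y, W x y = 1) :
    mutualInfo p W = ∑ x, p x * klSum (W x) (outMarginal p W) := by
  have hjoint : ∑ x, ∑ y, p x * W x y * Real.log (p x * W x y) =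
      ∑ x, p x * Real.log (p x) + ∑ x, ∑ y, p x * W x y * Real.log (W x y) := by
    rw [← Finset.sum_add_distrib]
    refine Finset.sum_congr rfl fun x _ => ?_
    have h : p x * Real.log (p x) = ∑ y, p x * W x y * Real.log (p x) := by
      rw [← Finset.sum_mul, ← Finset.mul_sum, hW, mul_one]
    rw [h, ← Finset.sum_add_distrib]
    refine Finset.sum_congr rfl fun y _ => ?_
    by_cases hpx : p x = 0
    · simp [hpx]
    by_cases hWxy : W x y = 0
    · simp [hWxy]
    rw [Real.log_mul hpx hWxy]
    ring
  rw [sum_mul_klSum]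
  simp only [mutualInfo, entropy, Fintype.sum_prod_type, hjoint]
  simp only [outMarginal]
  ring

theorem mul_klSum_outMarginal_nonneg (hp : IsProbVector p Set.univ)
    (hW : IsChannel W Set.univ) (x : X) : 0 ≤ p x * klSum (W x) (outMarginal p W) := by
  rcases (hp.1 x).eq_or_lt with h | h
  · simp [← h]
  refine mul_nonneg h.le (klSum_nonneg (hW.1 x) (outMarginal_nonneg hp.1 hW.1) (fun y hy => ?_) ?_)
  · exact (mul_eq_zero.1 (outMarginal_eq_zero hp.1 hW.1 hy x)).resolve_left h.ne'
  · rw [hW.2.1, sum_outMarginal hW.2.1, hp.2.1]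

theorem mutualInfo_nonneg (hp : IsProbVector p Set.univ) (hW : IsChannel W Set.univ) :
    0 ≤ mutualInfo p W := by
  rw [mutualInfo_eq_sum_klSum hW.2.1]
  exact Finset.sum_nonneg fun x _ => mul_klSum_outMarginal_nonneg hp hW x

/-- The output marginal minimises the average divergence of the rows. -/
theorem mutualInfo_le_sum_klSum (hp : IsProbVector p Set.univ) (hW : IsChannel W Set.univ)
    {r : Y → ℝ} (hr : ∀ y, 0 ≤ r y) (hr1 : ∑ y, r y = 1)
    (habs : ∀ y, r y = 0 → outMarginal p W y = 0) :
    mutualInfo p W ≤ ∑ x, p x * klSum (W x) r := by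
  have h := klSum_nonneg (outMarginal_nonneg hp.1 hW.1) hr habs
    (by rw [sum_outMarginal hW.2.1, hp.2.1, hr1])
  rw [mutualInfo_eq_sum_klSum hW.2.1, sum_mul_klSum, sum_mul_klSum]
  simp only [klSum, mul_sub, Finset.sum_sub_distrib] at h
  linarith

/-- If `P • μ` is the restriction of `p` to `A`, then `P · I(μ, W) ≤ I(p, W)`. -/
theorem mul_mutualInfo_le {μ : X → ℝ} {P : ℝ} {A : Set X} (hP : 0 < P)
    (hp : IsProbVector p Set.univ) (hμ : IsProbVector μ Set.univ) (hW : IsChannel W Set.univ)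
    (hPμ : ∀ x, P * μ x = if x ∈ A then p x else 0) :
    P * mutualInfo μ W ≤ mutualInfo p W := by
  have h : mutualInfo μ W ≤ ∑ x, μ x * klSum (W x) (outMarginal p W) := by
    refine mutualInfo_le_sum_klSum hμ hW (outMarginal_nonneg hp.1 hW.1)
      (by rw [sum_outMarginal hW.2.1, hp.2.1]) fun y hy => Finset.sum_eq_zero fun x _ => ?_
    have h0 := outMarginal_eq_zero hp.1 hW.1 hy x
    refine (mul_eq_zero.1 (?_ : P * (μ x * W x y) = 0)).resolve_left hP.ne'
    rw [← mul_assoc, hPμ]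
    split_ifs <;> simp [h0]
  refine (mul_le_mul_of_nonneg_left h hP.le).trans ?_
  rw [mutualInfo_eq_sum_klSum hW.2.1, Finset.mul_sum]
  refine Finset.sum_le_sum fun x _ => ?_
  rw [← mul_assoc, hPμ]
  split_ifs
  · exact le_rfl
  · rw [zero_mul]
    exact mul_klSum_outMarginal_nonneg hp hW x

/-- The channel that equals `V` on `A` and outputs the marginal of `(μ, V)` off `A`. -/
def extendChannel (A : Set X) (μ : X → ℝ) (V : X → Y → ℝ) : X → Y → ℝ :=
  fun x => if x ∈ A then V x else outMarginal μ V

theorem IsChannel.extendChannel {A : Set X} {μ : X → ℝ} {V : X → Y → ℝ} {S : Set Y}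
    (hμ : IsProbVector μ Set.univ) (hV : IsChannel V S) :
    IsChannel (extendChannel A μ V) S := by
  refine ⟨fun x y => ?_, fun x => ?_, fun x y => ?_⟩ <;> unfold _root_.extendChannel <;> split_ifs
  · exact hV.1 x y
  · exact outMarginal_nonneg hμ.1 hV.1 y
  · exact hV.2.1 x
  · rw [sum_outMarginal hV.2.1, hμ.2.1]
  · exact hV.2.2 x y
  · intro h
    obtain ⟨z, -, hz⟩ := Finset.exists_ne_zero_of_sum_ne_zero h
    exact hV.2.2 z y (right_ne_zero_of_mul hz)

omit [Fintype Y] in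
theorem outMarginal_extendChannel {μ : X → ℝ} {P : ℝ} {A : Set X} {V : X → Y → ℝ}
    (hp1 : ∑ x, p x = 1) (hμ1 : ∑ x, μ x = 1) (hPμ : ∀ x, P * μ x = if x ∈ A then p x else 0) :
    outMarginal p (extendChannel A μ V) = outMarginal μ V := by
  funext y
  have hterm : ∀ x, p x * extendChannel A μ V x y =
      P * (μ x * V x y) + (p x - P * μ x) * outMarginal μ V y := by
    intro x
    rw [← mul_assoc, hPμ, extendChannel]
    split_ifs <;> ring
  have hP : ∑ x, P * μ x = P := by rw [← Finset.mul_sum, hμ1, mul_one]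
  calc outMarginal p (extendChannel A μ V) y
      = ∑ x, (P * (μ x * V x y) + (p x - P * μ x) * outMarginal μ V y) :=
        Finset.sum_congr rfl fun x _ => hterm x
    _ = P * outMarginal μ V y + (1 - P) * outMarginal μ V y := by
        rw [Finset.sum_add_distrib, ← Finset.mul_sum, ← Finset.sum_mul, Finset.sum_sub_distrib,
          hp1, hP, outMarginal]
    _ = outMarginal μ V y := by ring

theorem mutualInfo_extendChannel {μ : X → ℝ} {P : ℝ} {A : Set X} {V : X → Y → ℝ}
    (hp1 : ∑ x, p x = 1) (hμ : IsProbVector μ Set.univ) (hV : IsChannel V Set.univ)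
    (hPμ : ∀ x, P * μ x = if x ∈ A then p x else 0) :
    mutualInfo p (extendChannel A μ V) = P * mutualInfo μ V := by
  rw [mutualInfo_eq_sum_klSum (IsChannel.extendChannel hμ hV).2.1,
    mutualInfo_eq_sum_klSum hV.2.1, outMarginal_extendChannel hp1 hμ.2.1 hPμ, Finset.mul_sum]
  refine Finset.sum_congr rfl fun x _ => ?_
  rw [← mul_assoc, hPμ, extendChannel]
  split_ifs
  · rfl
  · rw [klSum_self, mul_zero, zero_mul]

theorem mutualInfo_const (hp1 : ∑ x, p x = 1) {f : Y → ℝ} (hf : ∑ y, f y = 1) :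
    mutualInfo p (fun _ => f) = 0 := by
  have h : outMarginal p (fun _ => f) = f := by
    funext y
    rw [outMarginal, ← Finset.sum_mul, hp1, one_mul]
  rw [mutualInfo_eq_sum_klSum fun _ => hf, h]
  simp [klSum_self]

omit [Fintype X] in
theorem IsChannel.mono {S S' : Set Y} (hW : IsChannel W S) (h : S ⊆ S') : IsChannel W S' :=
  ⟨hW.1, hW.2.1, fun x y hxy => h (hW.2.2 x y hxy)⟩

theorem IsProbVector.mono {S S' : Set X} (hp : IsProbVector p S) (h : S ⊆ S') :
    IsProbVector p S' :=
  ⟨hp.1, hp.2.1, fun x hx => h (hp.2.2 x hx)⟩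

theorem massOn_mul_condOn {A : Set X} (hA : massOn p A ≠ 0) (x : X) :
    massOn p A * condOn p A x = if x ∈ A then p x else 0 := by
  rw [condOn]
  split_ifs
  · exact mul_div_cancel₀ _ hA
  · exact mul_zero _

theorem isProbVector_condOn {A : Set X} (hp : ∀ x, 0 ≤ p x) (hA : 0 < massOn p A) :
    IsProbVector (condOn p A) A := by
  refine ⟨fun x => ?_, mul_left_cancel₀ hA.ne' ?_, fun x hx => ?_⟩
  · rw [condOn]
    split_ifs
    · exact div_nonneg (hp x) hA.le
    · exact le_rfl
  · rw [Finset.mul_sum, mul_one]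
    exact Finset.sum_congr rfl fun x _ => massOn_mul_condOn hA.ne' x
  · by_contra h
    exact hx (if_neg h)

theorem eq_zero_of_massOn_eq_zero {A : Set X} (hp : ∀ x, 0 ≤ p x) (hA : massOn p A = 0) {x : X}
    (hx : x ∈ A) : p x = 0 := by
  have h := (Finset.sum_eq_zero_iff_of_nonneg fun x _ => by
    split_ifs
    · exact hp x
    · exact le_rfl).1 hA x (Finset.mem_univ x)
  rwa [if_pos hx] at h

end Channels

omit [Fintype 𝕊] in
/-- A statement outside the `δ`-core can be replaced by anything without distortion. -/
theorem dDelta_eq_zero {T : Set 𝕊 → Set 𝕊} (hinfl : ∀ B : Set 𝕊, B ⊆ T B)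
    (hmono : ∀ B B' : Set 𝕊, B ⊆ B' → T B ⊆ T B') {S_O : Set 𝕊} {δ : ℕ} {s : 𝕊}
    (hs : s ∈ S_O) (hs' : s ∉ deltaCore T S_O δ) (t : 𝕊) : dDelta T S_O δ s t = 0 := by
  have hT : Monotone T := fun B B' h => hmono B B' h
  have hsub : S_O \ {s} ⊆ S_O \ {s} ∪ {t} := Set.subset_union_left
  refine if_pos fun x hx => ?_
  by_cases hxs : x = s
  · subst hxs
    exact hT.iterate δ hsub (by_contra fun h => hs' ⟨hs, h⟩)
  · exact Function.id_le_iterate_of_id_le hinfl δ _ (hsub ⟨hx, hxs⟩)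

/-- Only the `δ`-core contributes to the expected `δ`-step distortion. -/
theorem mul_dDelta_eq {T : Set 𝕊 → Set 𝕊} (hinfl : ∀ B : Set 𝕊, B ⊆ T B)
    (hmono : ∀ B B' : Set 𝕊, B ⊆ B' → T B ⊆ T B') {S_O : Set 𝕊} {δ : ℕ} {p : 𝕊 → ℝ}
    (hp : IsProbVector p S_O) (W : 𝕊 → 𝕊 → ℝ) (s t : 𝕊) :
    p s * W s t * dDelta T S_O δ s t =
      (if s ∈ deltaCore T S_O δ then p s else 0) * W s t * dDelta T S_O δ s t := by
  split_ifs with h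
  · rfl
  by_cases hs : s ∈ S_O
  · simp [dDelta_eq_zero hinfl hmono hs h]
  · simp [not_imp_comm.1 (hp.2.2 s) hs]

theorem sum_dDelta_eq {T : Set 𝕊 → Set 𝕊} (hinfl : ∀ B : Set 𝕊, B ⊆ T B)
    (hmono : ∀ B B' : Set 𝕊, B ⊆ B' → T B ⊆ T B') {S_O : Set 𝕊} {δ : ℕ} {p μ : 𝕊 → ℝ} {P : ℝ}
    (hp : IsProbVector p S_O)
    (hPμ : ∀ s, P * μ s = if s ∈ deltaCore T S_O δ then p s else 0) {W V : 𝕊 → 𝕊 → ℝ}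
    (hWV : ∀ s ∈ deltaCore T S_O δ, W s = V s) :
    ∑ s, ∑ t, p s * W s t * dDelta T S_O δ s t =
      P * ∑ s, ∑ t, μ s * V s t * dDelta T S_O δ s t := by
  simp only [Finset.mul_sum]
  refine Finset.sum_congr rfl fun s _ => Finset.sum_congr rfl fun t _ => ?_
  rw [mul_dDelta_eq hinfl hmono hp, ← mul_assoc, ← mul_assoc, hPμ]
  split_ifs with h
  · rw [hWV s h]
  · simp only [zero_mul]

/-- Full rate–depth–distortion decomposition: for every
`D ≥ 0`: if `P_δ = 0` then `R_sem(D,δ) = 0`, and if `P_δ > 0` then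
`R_sem(D,δ) = P_δ · R^{(A_δ)}(D / P_δ)`. -/
theorem rate_depth_distortion_decomposition
    (T : Set 𝕊 → Set 𝕊)
    (hinfl : ∀ B : Set 𝕊, B ⊆ T B)
    (hmono : ∀ B B' : Set 𝕊, B ⊆ B' → T B ⊆ T B')
    (S_O Shat_O : Set 𝕊) (δ : ℕ)
    (p : 𝕊 → ℝ) (hp : IsProbVector p S_O)
    (hShatne : Shat_O.Nonempty) :
    ∀ D : ℝ, 0 ≤ D →
      (massOn p (deltaCore T S_O δ) = 0 →
        RsemDdelta T S_O Shat_O p D δ = 0) ∧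
      (0 < massOn p (deltaCore T S_O δ) →
        RsemDdelta T S_O Shat_O p D δ =
          ((massOn p (deltaCore T S_O δ) : ℝ) : EReal) *
            RdeltaCoreD T S_O Shat_O (condOn p (deltaCore T S_O δ))
              (D / massOn p (deltaCore T S_O δ)) δ) := by
  intro D hD
  have hp' := hp.mono (Set.subset_univ S_O)
  refine ⟨fun hA => le_antisymm ?_ (le_sInf ?_), fun hA => le_antisymm ?_ (le_sInf ?_)⟩
  · obtain ⟨t, ht⟩ := hShatne
    have hsum : ∑ y, Pi.single t (1 : ℝ) y = 1 := by simp
    refine sInf_le ⟨fun _ => Pi.single t 1, ⟨fun _ y => ?_, fun _ => hsum, fun _ y hy => ?_⟩, ?_, ?_⟩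
    · exact (Pi.single_nonneg (α := fun _ : 𝕊 => ℝ)).2 zero_le_one y
    · rcases eq_or_ne y t with rfl | hyt
      · exact ht
      · exact absurd (Pi.single_eq_of_ne hyt 1) hy
    · refine (Finset.sum_eq_zero fun s _ => Finset.sum_eq_zero fun y _ => ?_).trans_le hD
      refine (mul_dDelta_eq hinfl hmono hp (fun _ => Pi.single t 1) s y).trans ?_
      split_ifs with hs
      · rw [eq_zero_of_massOn_eq_zero hp.1 hA hs, zero_mul, zero_mul]
      · rw [zero_mul, zero_mul]
    · rw [mutualInfo_const hp.2.1 hsum, EReal.coe_zero]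
  · rintro _ ⟨W, hW, -, rfl⟩
    exact EReal.coe_nonneg.2 (mutualInfo_nonneg hp' (hW.mono (Set.subset_univ _)))
  · have hμ := (isProbVector_condOn hp.1 hA).mono (Set.subset_univ _)
    have hPμ := massOn_mul_condOn hA.ne'
    rw [← EReal.div_le_iff_le_mul (EReal.coe_pos.2 hA) (EReal.coe_ne_top _)]
    refine le_sInf ?_
    rintro _ ⟨V, hV, hVD, rfl⟩
    rw [EReal.div_le_iff_le_mul (EReal.coe_pos.2 hA) (EReal.coe_ne_top _)]
    refine sInf_le ⟨extendChannel (deltaCore T S_O δ) _ V, hV.extendChannel hμ, ?_, ?_⟩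
    · rwa [sum_dDelta_eq (V := V) hinfl hmono hp hPμ fun s hs => by rw [extendChannel, if_pos hs],
        ← le_div_iff₀' hA]
    · rw [mutualInfo_extendChannel hp.2.1 hμ (hV.mono (Set.subset_univ _)) hPμ, EReal.coe_mul]
  · rintro _ ⟨W, hW, hWD, rfl⟩
    have hμ := (isProbVector_condOn hp.1 hA).mono (Set.subset_univ _)
    have hPμ := massOn_mul_condOn hA.ne'
    rw [sum_dDelta_eq hinfl hmono hp hPμ fun _ _ => rfl, ← le_div_iff₀' hA] at hWD
    have hle : RdeltaCoreD T S_O Shat_O (condOn p (deltaCore T S_O δ))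
        (D / massOn p (deltaCore T S_O δ)) δ ≤ mutualInfo (condOn p (deltaCore T S_O δ)) W :=
      sInf_le ⟨W, hW, hWD, rfl⟩
    refine (mul_le_mul_of_nonneg_left hle (EReal.coe_nonneg.2 hA.le)).trans ?_
    rw [← EReal.coe_mul, EReal.coe_le_coe_iff]
    exact mul_mutualInfo_le hA hp' hμ (hW.mono (Set.subset_univ _)) hPμ

end
end
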